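/- Let a, a₁, a₂ > 0 and let Z = θ·ξ, where θ and ξ are independent, θ has the beta distribution with parameters (1 + a₁, a) (Lebesgue density x ↦ Γ(1+a₁+a)/(Γ(1+a₁)Γ(a))·x^{a₁}·(1−x)^{a−1} on (0,1)) and ξ has the gamma distribution with shape 1 + a₂ and rate 1. Then the law of Z has Lebesgue density f_Z(x) = [Γ(1+a₁+a)/(Γ(1+a₁)·Γ(1+a₂))]·e^{−x}·x^{a₂}·(1/Γ(a))·∫_0^∞ e^{−xs}·s^{a−1}·(1+s)^{a₂−a₁−a} ds for x > 0 (i.e., the last factor is the confluent hypergeometric function of the second kind U(a, 1 + a₂ − a₁, x)). -/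

import Mathlib

open MeasureTheory ProbabilityTheory Filter Set

/-- The multiplicative convolution of two measures with Lebesgue densities `h` and `g` has density
`x ↦ ∫ h t * |t|⁻¹ * g (x / t) dt`. -/
theorem map_mul_prod_withDensity {h g : ℝ → ENNReal} (hh : Measurable h) (hg : Measurable g) :
    (((volume : Measure ℝ).withDensity h).prod (volume.withDensity g)).map
        (fun p => p.1 * p.2) =
      volume.withDensity (fun x => ∫⁻ t, h t * (ENNReal.ofReal |t⁻¹| * g (x / t))) := by
  have hmeas : Measurable
      (fun p : ℝ × ℝ => h p.2 * (ENNReal.ofReal |p.2⁻¹| * g (p.1 / p.2))) := by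
    have h_div : Measurable (fun p : ℝ × ℝ => g (p.1 / p.2)) :=
      hg.comp (measurable_fst.div measurable_snd)
    have h_inv : Measurable (fun p : ℝ × ℝ => ENNReal.ofReal |p.2⁻¹|) :=
      (measurable_snd.inv.abs).ennreal_ofReal
    exact (hh.comp measurable_snd).mul (h_inv.mul h_div)
  refine Measure.ext_of_lintegral _ fun F hF => ?_
  have hFmul : Measurable (fun p : ℝ × ℝ => F (p.1 * p.2)) :=
    hF.comp (measurable_fst.mul measurable_snd)
  rw [lintegral_map hF (by fun_prop), lintegral_prod _ hFmul.aemeasurable,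
    lintegral_withDensity_eq_lintegral_mul _ hh hFmul.lintegral_prod_right',
    lintegral_withDensity_eq_lintegral_mul _ hmeas.lintegral_prod_right' hF]
  have hscale : ∀ t : ℝ, t ≠ 0 → ∫⁻ y, F (t * y) ∂(volume.withDensity g) =
      ∫⁻ x, ENNReal.ofReal |t⁻¹| * g (x / t) * F x := by
    intro t ht
    have hgt : Measurable (fun x => g (x / t)) := hg.comp (measurable_id.div_const t)
    have hGt : Measurable (fun x => g (x / t) * F x) := hgt.mul hF
    rw [lintegral_withDensity_eq_lintegral_mul _ hg
      (g := fun y => F (t * y)) (hF.comp (measurable_const_mul t))]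
    simp_rw [mul_assoc]
    rw [lintegral_const_mul _ hGt]
    have hmap := lintegral_map (μ := volume) hGt (measurable_const_mul t)
    rw [Real.map_volume_mul_left ht, lintegral_smul_measure, smul_eq_mul] at hmap
    rw [hmap]
    refine lintegral_congr fun y => ?_
    simp [mul_div_cancel_left₀ _ ht]
  calc _ = ∫⁻ t, ∫⁻ x, h t * (ENNReal.ofReal |t⁻¹| * g (x / t)) * F x := by
        refine lintegral_congr_ae ?_
        filter_upwards [compl_mem_ae_iff.mpr (measure_singleton (0 : ℝ))] with t ht
        have hgt : Measurable (fun x => g (x / t)) := hg.comp (measurable_id.div_const t)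
        simp only [Pi.mul_apply, hscale t ht]
        rw [← lintegral_const_mul _ (by fun_prop)]
        simp_rw [mul_assoc]
    _ = ∫⁻ x, ∫⁻ t, h t * (ENNReal.ofReal |t⁻¹| * g (x / t)) * F x :=
        lintegral_lintegral_swap
          ((hmeas.comp measurable_swap).mul (hF.comp measurable_snd)).aemeasurable
    _ = _ := by
        refine lintegral_congr fun x => ?_
        exact lintegral_mul_const _ (hmeas.comp measurable_prodMk_left)

/-- The substitution `t = (1 + s)⁻¹` from `(0, ∞)` to `(0, 1)`. -/
theorem setLIntegral_Ioo_zero_one_eq (F : ℝ → ENNReal) :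
    ∫⁻ t in Ioo (0 : ℝ) 1, F t =
      ∫⁻ s in Ioi (0 : ℝ), ENNReal.ofReal (((1 + s) ^ 2)⁻¹) * F (1 + s)⁻¹ := by
  have himage : (fun s : ℝ => (1 + s)⁻¹) '' Ioi 0 = Ioo 0 1 := by
    ext t
    simp only [mem_image, mem_Ioi, mem_Ioo]
    constructor
    · rintro ⟨s, hs, rfl⟩
      exact ⟨by positivity, inv_lt_one_of_one_lt₀ (by linarith)⟩
    · rintro ⟨h0, h1⟩
      exact ⟨t⁻¹ - 1, sub_pos.mpr ((one_lt_inv₀ h0).mpr h1), by simp⟩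
  rw [← himage, lintegral_image_eq_lintegral_abs_deriv_mul measurableSet_Ioi
    (f' := fun s => -1 / (1 + s) ^ 2)]
  · refine setLIntegral_congr_fun measurableSet_Ioi fun s hs => ?_
    have : |(-1 : ℝ) / (1 + s) ^ 2| = ((1 + s) ^ 2)⁻¹ := by
      rw [abs_div, abs_neg, abs_one, abs_of_nonneg (by positivity), one_div]
    simp only [this]
  · intro s hs
    have hs' : (1 : ℝ) + s ≠ 0 := by have := mem_Ioi.mp hs; positivity
    exact (((hasDerivAt_id s).const_add 1).inv hs').hasDerivWithinAt
  · intro s _ t _ hst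
    simpa using hst

/-- The integrand of the multiplicative convolution of beta and gamma densities, after the
substitution `t = (1 + s)⁻¹`. -/
theorem beta_gamma_integrand_eq {a a₁ a₂ x s : ℝ} (hx : 0 < x) (hs : 0 < s) (C D E : ℝ) :
    ((1 + s) ^ 2)⁻¹ * (C / (D * Real.Gamma a) * (1 + s)⁻¹ ^ a₁ * (1 - (1 + s)⁻¹) ^ (a - 1) *
        ((1 + s) * (1 / E * (x * (1 + s)) ^ a₂ * Real.exp (-(x * (1 + s)))))) =
      C / (D * E) * Real.exp (-x) * x ^ a₂ * (1 / Real.Gamma a) *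
        (Real.exp (-(x * s)) * s ^ (a - 1) * (1 + s) ^ (a₂ - a₁ - a)) := by
  have hu : 0 < 1 + s := by linarith
  have h1 : 1 - (1 + s)⁻¹ = s * (1 + s)⁻¹ := by field_simp; ring
  have h2 : Real.exp (-(x * (1 + s))) = Real.exp (-x) * Real.exp (-(x * s)) := by
    rw [← Real.exp_add]; ring_nf
  have h3 : (1 + s) ^ (a₂ - a₁ - a) =
      ((1 + s) ^ 2)⁻¹ * (1 + s)⁻¹ ^ a₁ * (1 + s)⁻¹ ^ (a - 1) * (1 + s) * (1 + s) ^ a₂ := by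
    rw [Real.inv_rpow hu.le, Real.inv_rpow hu.le, Real.rpow_sub hu, Real.rpow_sub hu,
      Real.rpow_sub hu, Real.rpow_one]
    field_simp
  rw [h1, h2, h3, Real.mul_rpow hs.le (by positivity), Real.mul_rpow hx.le hu.le]
  ring

/-- If `θ` is beta-distributed with parameters `(1 + a₁, a)` and `ξ` is
gamma-distributed with shape `1 + a₂` and rate `1`, independent of each other, then the
law of `Z = θ·ξ` has Lebesgue density
`f_Z(x) = Γ(1+a₁+a)/(Γ(1+a₁)Γ(1+a₂)) · e^{-x} x^{a₂} · U(a, 1+a₂-a₁, x)` for `x > 0`,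
where `U(a,b,x) = Γ(a)⁻¹ ∫_0^∞ e^{-xs} s^{a-1} (1+s)^{b-a-1} ds` is the confluent
hypergeometric function of the second kind. -/
theorem beta_gamma_product_density
    {Ω : Type*} [MeasurableSpace Ω] (μ : Measure Ω) [IsProbabilityMeasure μ]
    (a a₁ a₂ : ℝ) (ha : 0 < a) (ha₁ : 0 < a₁) (ha₂ : 0 < a₂)
    (θ ξ : Ω → ℝ) (hθmeas : Measurable θ) (hξmeas : Measurable ξ)
    (hindep : IndepFun θ ξ μ)
    (hθlaw : μ.map θ = volume.withDensity (fun x => ENNReal.ofReal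
      ((Set.Ioo (0:ℝ) 1).indicator (fun x =>
        Real.Gamma (1 + a₁ + a) / (Real.Gamma (1 + a₁) * Real.Gamma a) *
          x ^ a₁ * (1 - x) ^ (a - 1)) x)))
    (hξlaw : μ.map ξ = ProbabilityTheory.gammaMeasure (1 + a₂) 1) :
    μ.map (fun ω => θ ω * ξ ω) =
      volume.withDensity (fun x => ENNReal.ofReal
        ((Set.Ioi (0:ℝ)).indicator (fun x =>
          Real.Gamma (1 + a₁ + a) / (Real.Gamma (1 + a₁) * Real.Gamma (1 + a₂)) *
            Real.exp (-x) * x ^ a₂ *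
            ((1 / Real.Gamma a) *
              ∫ s in Set.Ioi (0:ℝ),
                Real.exp (-(x * s)) * s ^ (a - 1) * (1 + s) ^ (a₂ - a₁ - a))) x)) := by
  set h : ℝ → ENNReal := fun x => ENNReal.ofReal
      ((Set.Ioo (0:ℝ) 1).indicator (fun x =>
        Real.Gamma (1 + a₁ + a) / (Real.Gamma (1 + a₁) * Real.Gamma a) *
          x ^ a₁ * (1 - x) ^ (a - 1)) x) with h_def
  have hh : Measurable h := by
    refine Measurable.ennreal_ofReal (Measurable.indicator ?_ measurableSet_Ioo)
    fun_prop
  have hg : Measurable (gammaPDF (1 + a₂) 1) := (measurable_gammaPDFReal _ _).ennreal_ofReal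
  have hlaw : μ.map (fun ω => θ ω * ξ ω) = volume.withDensity
      (fun x => ∫⁻ t, h t * (ENNReal.ofReal |t⁻¹| * gammaPDF (1 + a₂) 1 (x / t))) := by
    rw [← map_mul_prod_withDensity hh hg, ← hθlaw, ← gammaMeasure, ← hξlaw,
      ← hindep.map_prod_eq_prod_map_map hθmeas.aemeasurable hξmeas.aemeasurable,
      Measure.map_map (by fun_prop) (hθmeas.prodMk hξmeas)]
    rfl
  have hmeas : Measurable (fun x =>
      ∫⁻ t, h t * (ENNReal.ofReal |t⁻¹| * gammaPDF (1 + a₂) 1 (x / t))) := by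
    have h_div : Measurable (fun p : ℝ × ℝ => gammaPDF (1 + a₂) 1 (p.1 / p.2)) :=
      hg.comp (measurable_fst.div measurable_snd)
    have h_inv : Measurable (fun p : ℝ × ℝ => ENNReal.ofReal |p.2⁻¹|) :=
      (measurable_snd.inv.abs).ennreal_ofReal
    exact ((hh.comp measurable_snd).mul (h_inv.mul h_div)).lintegral_prod_right'
  have hfin : ∫⁻ x, ∫⁻ t, h t * (ENNReal.ofReal |t⁻¹| * gammaPDF (1 + a₂) 1 (x / t)) ≠ ⊤ := by
    have : IsProbabilityMeasure (μ.map (fun ω => θ ω * ξ ω)) :=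
      Measure.isProbabilityMeasure_map (hθmeas.mul hξmeas).aemeasurable
    rw [← setLIntegral_univ, ← withDensity_apply _ MeasurableSet.univ, ← hlaw]
    exact measure_ne_top _ _
  have hG : 0 < Real.Gamma a := Real.Gamma_pos_of_pos ha
  have hG₁ : 0 < Real.Gamma (1 + a₁) := Real.Gamma_pos_of_pos (by linarith)
  have hG₂ : 0 < Real.Gamma (1 + a₂) := Real.Gamma_pos_of_pos (by linarith)
  have hG₃ : 0 < Real.Gamma (1 + a₁ + a) := Real.Gamma_pos_of_pos (by linarith)
  rw [hlaw]
  refine withDensity_congr_ae ?_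
  filter_upwards [ae_lt_top hmeas hfin, compl_mem_ae_iff.mpr (measure_singleton (0 : ℝ))]
    with x hxfin hx0
  have hind : ∫⁻ t, h t * (ENNReal.ofReal |t⁻¹| * gammaPDF (1 + a₂) 1 (x / t)) =
      ∫⁻ t in Ioo (0 : ℝ) 1, h t * (ENNReal.ofReal |t⁻¹| * gammaPDF (1 + a₂) 1 (x / t)) := by
    refine (setLIntegral_eq_of_support_subset ?_).symm
    intro t ht
    by_contra hmem
    exact ht (by simp [h_def, indicator_of_notMem hmem])
  rcases lt_or_gt_of_ne hx0 with hx | hx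
  · rw [hind, indicator_of_notMem (by simpa using hx.le), ENNReal.ofReal_zero,
      setLIntegral_congr_fun measurableSet_Ioo (g := fun _ => 0), lintegral_zero]
    intro t ht
    simp [gammaPDF_of_neg (div_neg_of_neg_of_pos hx ht.1)]
  · set k : ℝ → ℝ := fun s =>
      Real.exp (-(x * s)) * s ^ (a - 1) * (1 + s) ^ (a₂ - a₁ - a) with hk
    have hkmeas : Measurable k := by fun_prop
    have hk0 : ∀ s ∈ Ioi (0 : ℝ), 0 ≤ k s := fun s hs => by
      have := mem_Ioi.mp hs
      positivity
    set K : ℝ := Real.Gamma (1 + a₁ + a) / (Real.Gamma (1 + a₁) * Real.Gamma (1 + a₂)) *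
      Real.exp (-x) * x ^ a₂ * (1 / Real.Gamma a) with hK
    have hKpos : 0 < K := by positivity
    have hD : ∫⁻ t, h t * (ENNReal.ofReal |t⁻¹| * gammaPDF (1 + a₂) 1 (x / t)) =
        ENNReal.ofReal K * ∫⁻ s in Ioi (0 : ℝ), ENNReal.ofReal (k s) := by
      rw [hind, setLIntegral_Ioo_zero_one_eq, ← lintegral_const_mul _ (by fun_prop)]
      refine setLIntegral_congr_fun measurableSet_Ioi fun s hs => ?_
      have hs : 0 < s := hs
      have hmem : (1 + s)⁻¹ ∈ Ioo (0 : ℝ) 1 :=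
        ⟨by positivity, inv_lt_one_of_one_lt₀ (by linarith)⟩
      have hsub : 0 ≤ 1 - (1 + s)⁻¹ := sub_nonneg.mpr hmem.2.le
      simp only [h_def]
      rw [indicator_of_mem hmem, div_inv_eq_mul, inv_inv, abs_of_pos (by positivity),
        gammaPDF_of_nonneg (by positivity), ← ENNReal.ofReal_mul (by positivity),
        ← ENNReal.ofReal_mul (by positivity), ← ENNReal.ofReal_mul (by positivity),
        ← ENNReal.ofReal_mul hKpos.le, hK, hk, ← beta_gamma_integrand_eq hx hs]
      simp only [Real.one_rpow, one_mul, add_sub_cancel_left]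
    rw [hD] at hxfin ⊢
    have hkfin : ∫⁻ s in Ioi (0 : ℝ), ENNReal.ofReal (k s) < ⊤ :=
      ENNReal.lt_top_of_mul_ne_top_right hxfin.ne (ENNReal.ofReal_pos.mpr hKpos).ne'
    have hk0' : 0 ≤ᵐ[volume.restrict (Ioi (0 : ℝ))] k :=
      (ae_restrict_mem measurableSet_Ioi).mono hk0
    have hkint : IntegrableOn k (Ioi 0) :=
      ⟨hkmeas.aestronglyMeasurable, (hasFiniteIntegral_iff_ofReal hk0').mpr hkfin⟩
    rw [← ofReal_integral_eq_lintegral_ofReal hkint hk0', ← ENNReal.ofReal_mul hKpos.le,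
      indicator_of_mem (mem_Ioi.mpr hx), hK]
    exact congrArg ENNReal.ofReal (mul_assoc _ _ _)
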